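/- arXiv:1811.11281 — 7 statements merged into one kernel-verified Lean document; each statement's English description precedes it below -/
import Mathlib

section
/- Let J : E → ℝ be convex and absolutely one-homogeneous, let λ > 0 and f ∈ E satisfy λ • f ∈ ∂J(f), and define u : ℝ → E by u(t) = max(1 − λt, 0) • f. Then u(0) = f and the gradient flow equation u'(t) ∈ −∂J(u(t)) holds pointwise away from the extinction time: for every t ≥ 0 with t ≠ 1/λ, u is differentiable at t with derivative g(t), and −g(t) ∈ ∂J(u(t)); explicitly, g(t) = −λ • f for 0 ≤ t < 1/λ and g(t) = 0 for t > 1/λ. -/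
open RealInnerProductSpace

variable {E : Type*} [NormedAddCommGroup E] [InnerProductSpace ℝ E]

/-- `J` is absolutely one-homogeneous: `J (c • u) = |c| * J u`. -/
def AbsOneHomog (J : E → ℝ) : Prop :=
  ∀ (c : ℝ) (u : E), J (c • u) = |c| * J u

/-- `p` is a subgradient of `J` at `u`: `J v ≥ J u + ⟨p, v - u⟩` for all `v`. -/
def IsSubgradientAt (J : E → ℝ) (p u : E) : Prop :=
  ∀ v : E, J u + ⟪p, v - u⟫ ≤ J v

/-- A convex absolutely one-homogeneous functional is nonnegative. -/
theorem AbsOneHomog.nonneg {J : E → ℝ} (hhom : AbsOneHomog J)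
    (hconv : ConvexOn ℝ Set.univ J) (v : E) : 0 ≤ J v := by
  have h0 : J 0 = 0 := by simpa using hhom 0 0
  have hneg : J (-v) = J v := by simpa using hhom (-1) v
  have h := hconv.2 (Set.mem_univ v) (Set.mem_univ (-v))
    (by norm_num : (0 : ℝ) ≤ 1 / 2) (by norm_num : (0 : ℝ) ≤ 1 / 2) (by norm_num)
  rw [smul_neg, add_neg_cancel, h0, hneg, smul_eq_mul] at h
  linarith

/-- Subgradients of absolutely one-homogeneous functionals are invariant under positive scaling
of the base point. -/
theorem IsSubgradientAt.smul_of_pos {J : E → ℝ} {p w : E} (h : IsSubgradientAt J p w)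
    (hhom : AbsOneHomog J) {c : ℝ} (hc : 0 < c) : IsSubgradientAt J p (c • w) := by
  intro v
  have hv : c • (c⁻¹ • v) = v := smul_inv_smul₀ hc.ne' v
  have hJ : J v = c * J (c⁻¹ • v) := by
    rw [← abs_of_pos hc, ← hhom, abs_of_pos hc, hv]
  have hsub : v - c • w = c • (c⁻¹ • v - w) := by rw [smul_sub, hv]
  rw [hJ, hhom, abs_of_pos hc, hsub, real_inner_smul_right, ← mul_add]
  exact mul_le_mul_of_nonneg_left (h _) hc.le

/-- If `λ • f ∈ ∂J(f)` with `λ > 0`, then `u(t) = max (1 - λ t) 0 • f` solves the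
gradient flow `u' ∈ -∂J(u)`, `u(0) = f`, away from the extinction time `1/λ`:
`u` is differentiable there with derivative `g(t)`, where `g(t) = -(λ • f)` for
`0 ≤ t < 1/λ` and `g(t) = 0` for `t > 1/λ`, and `-g(t) ∈ ∂J(u(t))`. -/
theorem gradient_flow_solution_of_eigenfunction
    (J : E → ℝ) (hconv : ConvexOn ℝ Set.univ J) (hhom : AbsOneHomog J)
    (lam : ℝ) (hlam : 0 < lam) (f : E) (hf : IsSubgradientAt J (lam • f) f)
    (u : ℝ → E) (hu : ∀ t : ℝ, u t = max (1 - lam * t) 0 • f)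
    (g : ℝ → E)
    (hg₁ : ∀ t : ℝ, 0 ≤ t → t < 1 / lam → g t = -(lam • f))
    (hg₂ : ∀ t : ℝ, 1 / lam < t → g t = 0) :
    u 0 = f ∧
      ∀ t : ℝ, 0 ≤ t → t ≠ 1 / lam →
        HasDerivAt u (g t) t ∧ IsSubgradientAt J (-(g t)) (u t) := by
  refine ⟨by simp [hu], fun t ht hne => ?_⟩
  rcases lt_or_gt_of_ne hne with hlt | hgt
  · have hpos : ∀ s : ℝ, s < 1 / lam → 0 < 1 - lam * s := fun s hs => by
      rw [lt_div_iff₀' hlam] at hs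
      linarith
    rw [hg₁ t ht hlt]
    constructor
    · have hd : HasDerivAt (fun s : ℝ => (1 - lam * s) • f) (-(lam • f)) t := by
        simpa using (((hasDerivAt_id t).const_mul lam).const_sub 1).smul_const f
      refine hd.congr_of_eventuallyEq ?_
      filter_upwards [Iio_mem_nhds hlt] with s hs
      rw [hu, max_eq_left (hpos s hs).le]
    · rw [neg_neg, hu, max_eq_left (hpos t hlt).le]
      exact hf.smul_of_pos hhom (hpos t hlt)
  · have hzero : ∀ s : ℝ, 1 / lam < s → u s = 0 := fun s hs => by
      rw [div_lt_iff₀' hlam] at hs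
      rw [hu, max_eq_right (by linarith), zero_smul]
    rw [hg₂ t hgt]
    constructor
    · refine (hasDerivAt_const t (0 : E)).congr_of_eventuallyEq ?_
      filter_upwards [Ioi_mem_nhds hgt] with s hs using hzero s hs
    · intro v
      have h0 : J 0 = 0 := by simpa using hhom 0 0
      simpa [hzero t hgt, h0] using hhom.nonneg hconv v
end

section
/- Let J : E → ℝ be convex and absolutely one-homogeneous, let λ > 0 and f ∈ E satisfy λ • f ∈ ∂J(f), and let t ≥ 0. Then u* := max(1 − λt, 0) • f is the unique minimizer over E of the ROF-type energy E(u) = t · J(u) + (1/2)‖u − f‖²; that is, E(u*) ≤ E(u) for all u ∈ E, with equality only when u = u*. -/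
open RealInnerProductSpace

variable {E : Type*} [NormedAddCommGroup E] [InnerProductSpace ℝ E]

theorem AbsOneHomog.apply_zero {J : E → ℝ} (hhom : AbsOneHomog J) : J 0 = 0 := by
  simpa using hhom 0 0

/-- An eigenfunction `f` of `∂J` satisfies the Euler identity `J f = λ ‖f‖²`. -/
theorem IsSubgradientAt.apply_eq_of_smul_self {J : E → ℝ} (hhom : AbsOneHomog J) {lam : ℝ} {f : E}
    (hf : IsSubgradientAt J (lam • f) f) : J f = lam * ‖f‖ ^ 2 := by
  have h0 := hf 0
  have h2 := hf ((2 : ℝ) • f)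
  rw [hhom.apply_zero, zero_sub, inner_neg_right, real_inner_smul_left,
    real_inner_self_eq_norm_sq] at h0
  rw [hhom, abs_of_pos two_pos, two_smul, add_sub_cancel_right, real_inner_smul_left,
    real_inner_self_eq_norm_sq] at h2
  linarith

/-- An eigenvector subgradient is a linear minorant of `J`. -/
theorem IsSubgradientAt.mul_inner_le {J : E → ℝ} (hhom : AbsOneHomog J) {lam : ℝ} {f : E}
    (hf : IsSubgradientAt J (lam • f) f) (u : E) : lam * ⟪u, f⟫ ≤ J u := by
  have hu := hf u
  rw [hf.apply_eq_of_smul_self hhom, real_inner_smul_left, inner_sub_right,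
    real_inner_self_eq_norm_sq, real_inner_comm] at hu
  linarith

/-- Quadratic growth of the ROF energy around `max (1 - λ t) 0 • f`. -/
theorem IsSubgradientAt.rof_energy_add_le {J : E → ℝ} (hhom : AbsOneHomog J) {lam : ℝ}
    (hlam : 0 < lam) {f : E} (hf : IsSubgradientAt J (lam • f) f) {t : ℝ} (ht : 0 ≤ t) (u : E) :
    t * J (max (1 - lam * t) 0 • f) + (1 / 2) * ‖max (1 - lam * t) 0 • f - f‖ ^ 2
        + (1 / 2) * ‖u - max (1 - lam * t) 0 • f‖ ^ 2
      ≤ t * J u + (1 / 2) * ‖u - f‖ ^ 2 := by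
  have hle := hf.mul_inner_le hhom u
  have hneg := hf.mul_inner_le hhom (-u)
  have hsymm : J (-u) = J u := by simpa using hhom (-1) u
  rw [hsymm, inner_neg_left] at hneg
  have hJu : 0 ≤ J u := by linarith
  rw [hhom, hf.apply_eq_of_smul_self hhom, abs_of_nonneg (le_max_right _ _)]
  rcases le_total (lam * t) 1 with h | h
  · rw [max_eq_left (by linarith)]
    have hdiff : (1 - lam * t) • f - f = (-(lam * t)) • f := by module
    rw [hdiff, norm_smul, mul_pow, Real.norm_eq_abs, sq_abs, norm_sub_sq_real u f,
      norm_sub_sq_real u, norm_smul, mul_pow, Real.norm_eq_abs, sq_abs, real_inner_smul_right]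
    linarith [mul_le_mul_of_nonneg_left hle ht]
  · rw [max_eq_right (by linarith)]
    simp only [zero_smul, zero_sub, norm_neg, sub_zero, norm_sub_sq_real u f]
    have hinner : ⟪u, f⟫ ≤ t * J u := by
      refine le_of_mul_le_mul_left ?_ hlam
      linarith [mul_le_mul_of_nonneg_right h hJu]
    linarith

/-- If `λ • f ∈ ∂J(f)` with `λ > 0` and `t ≥ 0`, then `u* = max (1 - λ t) 0 • f`
is the unique minimizer of the ROF-type energy `u ↦ t * J u + ½ ‖u - f‖²`. -/
theorem rof_minimizer_of_eigenfunction
    (J : E → ℝ) (hconv : ConvexOn ℝ Set.univ J) (hhom : AbsOneHomog J)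
    (lam : ℝ) (hlam : 0 < lam) (f : E) (hf : IsSubgradientAt J (lam • f) f)
    (t : ℝ) (ht : 0 ≤ t) :
    ∀ u : E,
      (t * J (max (1 - lam * t) 0 • f) + (1 / 2) * ‖max (1 - lam * t) 0 • f - f‖ ^ 2
          ≤ t * J u + (1 / 2) * ‖u - f‖ ^ 2) ∧
      (t * J (max (1 - lam * t) 0 • f) + (1 / 2) * ‖max (1 - lam * t) 0 • f - f‖ ^ 2
          = t * J u + (1 / 2) * ‖u - f‖ ^ 2 → u = max (1 - lam * t) 0 • f) := by
  intro u
  have key := hf.rof_energy_add_le hhom hlam ht u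
  have hsq := sq_nonneg ‖u - max (1 - lam * t) 0 • f‖
  refine ⟨by linarith, fun heq => ?_⟩
  rw [← sub_eq_zero, ← norm_eq_zero, ← sq_eq_zero_iff]
  linarith
end

section
/- Let J : E → ℝ be convex and absolutely one-homogeneous, let λ > 0 and f ∈ E satisfy λ • f ∈ ∂J(f). Then along the gradient-flow solution u(t) = (1 − λt) • f the energy decreases at rate minus the squared norm of the subgradient: for every t ∈ (0, 1/λ), the function s ↦ J((1 − λs) • f) is differentiable at t with derivative equal to −‖λ • f‖². -/
open RealInnerProductSpace

variable {E : Type*} [NormedAddCommGroup E] [InnerProductSpace ℝ E]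

/-- Euler's identity for subgradients of absolutely one-homogeneous functionals. -/
theorem AbsOneHomog.eq_inner_of_isSubgradientAt {J : E → ℝ} (hhom : AbsOneHomog J) {p u : E}
    (hp : IsSubgradientAt J p u) : J u = ⟪p, u⟫ := by
  have h0 := hp ((0 : ℝ) • u)
  have h2 := hp ((2 : ℝ) • u)
  rw [hhom, inner_sub_right, inner_smul_right] at h0 h2
  norm_num at h0 h2
  linarith

/-- Along the gradient-flow solution `u(t) = (1 - λ t) • f` of an eigenfunction,
the energy decreases at rate `-‖λ • f‖²`: for `t ∈ (0, 1/λ)`, the map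
`s ↦ J ((1 - λ s) • f)` is differentiable at `t` with derivative `-‖λ • f‖²`. -/
theorem energy_dissipation_of_eigenfunction
    (J : E → ℝ) (hconv : ConvexOn ℝ Set.univ J) (hhom : AbsOneHomog J)
    (lam : ℝ) (hlam : 0 < lam) (f : E) (hf : IsSubgradientAt J (lam • f) f) :
    ∀ t ∈ Set.Ioo (0 : ℝ) (1 / lam),
      HasDerivAt (fun s : ℝ => J ((1 - lam * s) • f)) (-‖lam • f‖ ^ 2) t := by
  rintro t ⟨-, ht⟩
  have hpos : 0 < 1 - lam * t := by
    rw [lt_div_iff₀ hlam] at ht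
    linarith
  have hJ : J f = lam * ‖f‖ ^ 2 := by
    rw [hhom.eq_inner_of_isSubgradientAt hf, real_inner_smul_left, real_inner_self_eq_norm_sq]
  have hlin : HasDerivAt (fun s : ℝ => (1 - lam * s) * J f) (-‖lam • f‖ ^ 2) t := by
    refine ((((hasDerivAt_id t).const_mul lam).const_sub 1).mul_const (J f)).congr_deriv ?_
    rw [hJ, norm_smul, Real.norm_of_nonneg hlam.le]
    ring
  refine hlin.congr_of_eventuallyEq ?_
  have hcont : Continuous fun s : ℝ => 1 - lam * s := by fun_prop
  filter_upwards [hcont.continuousAt.eventually (lt_mem_nhds hpos)] with s hs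
  rw [hhom, abs_of_pos hs]
end

section
/- Let a > 0 and 0 < R < R₀ be real numbers, set c₀ = 1 − R²/R₀², and define the vector field F : ℝ² \ {0} → ℝ² by F(y) = (a·R/c₀)·(‖y‖⁻² − R₀⁻²) • y. Then F is differentiable at every x ≠ 0 and its divergence (the trace of its Fréchet derivative) is constant: div F(x) = −2aR/(c₀·R₀²) for every x ≠ 0. -/
/-- The Euclidean plane. -/
abbrev Plane := EuclideanSpace ℝ (Fin 2)

/-- The divergence of a planar vector field: the trace of its Fréchet
derivative. -/
noncomputable def divg (F : Plane → Plane) (x : Plane) : ℝ :=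
  LinearMap.trace ℝ Plane (fderiv ℝ F x).toLinearMap

/-- A field that agrees near `x` with `y ↦ g y • y` is differentiable at `x`, with divergence
twice `g x` plus the derivative of `g` at `x` in direction `x`. -/
theorem differentiableAt_and_divg_of_eventuallyEq_smul_self
    {g : Plane → ℝ} {g' : Plane →L[ℝ] ℝ} {F : Plane → Plane} {x : Plane}
    (hg : HasFDerivAt g g' x) (hF : F =ᶠ[nhds x] fun y => g y • y) :
    DifferentiableAt ℝ F x ∧ divg F x = 2 * g x + g' x := by
  have h : HasFDerivAt F (g x • ContinuousLinearMap.id ℝ Plane + g'.smulRight x) x :=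
    (hg.smul (hasFDerivAt_id x)).congr_of_eventuallyEq hF
  refine ⟨h.differentiableAt, ?_⟩
  have e : (g x • ContinuousLinearMap.id ℝ Plane + g'.smulRight x).toLinearMap =
      g x • LinearMap.id + (g' : Plane →ₗ[ℝ] ℝ).smulRight x := rfl
  rw [divg, h.fderiv, e, map_add, map_smul, LinearMap.trace_id, LinearMap.trace_smulRight]
  simp [mul_comm]

/-- The annulus portion `F(y) = (a R / c₀)(‖y‖⁻² - R₀⁻²) • y` of the calibrating
vector field of the A²TV disk example is differentiable away from the origin and
has constant divergence `-2 a R / (c₀ R₀²)` there. -/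
theorem annulus_field_constant_divergence
    (a R R₀ c₀ : ℝ) (ha : 0 < a) (hR : 0 < R) (hRR₀ : R < R₀)
    (hc₀ : c₀ = 1 - R ^ 2 / R₀ ^ 2)
    (F : Plane → Plane)
    (hF : ∀ y : Plane, y ≠ 0 →
      F y = (a * R / c₀ * ((‖y‖ ^ 2)⁻¹ - (R₀ ^ 2)⁻¹)) • y) :
    ∀ x : Plane, x ≠ 0 →
      DifferentiableAt ℝ F x ∧ divg F x = -(2 * a * R / (c₀ * R₀ ^ 2)) := by
  intro x hx
  have hn : ‖x‖ ≠ 0 := norm_ne_zero_iff.mpr hx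
  have hsq : HasFDerivAt (fun y : Plane => ‖y‖ ^ 2) (2 • innerSL ℝ x) x :=
    (hasStrictFDerivAt_norm_sq x).hasFDerivAt
  have hg := (((hasDerivAt_inv (pow_ne_zero 2 hn)).comp_hasFDerivAt x hsq).sub_const
    (R₀ ^ 2)⁻¹).const_mul (a * R / c₀)
  obtain ⟨hd, hdiv⟩ := differentiableAt_and_divg_of_eventuallyEq_smul_self hg (F := F)
    ((isOpen_ne.eventually_mem hx).mono fun y hy => hF y hy)
  refine ⟨hd, hdiv.trans ?_⟩
  simp only [Function.comp_apply, _root_.smul_apply, innerSL_apply_apply,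
    real_inner_self_eq_norm_sq, smul_eq_mul, nsmul_eq_mul]
  field_simp
  ring
end

section
/- (Pairing inequality.) Let C ⊆ ℝ² be a measurable set, λ ∈ ℝ, and let ξ : ℝ² → ℝ² be a measurable vector field with ‖ξ(x)‖ ≤ 1 for almost every x and with distributional divergence λ·χ_C. Then for every bounded measurable set D ⊆ ℝ² of finite variational perimeter, λ · vol(C ∩ D) ≤ Per(D). -/
open MeasureTheory RealInnerProductSpace
open scoped ENNReal

/-- The values `∫_E div ξ` over smooth compactly supported fields `ξ` with
`‖ξ‖ ≤ 1`, whose supremum is the variational perimeter of `E`. -/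
def perimVals (E : Set Plane) : Set ℝ≥0∞ :=
  {r | ∃ ξ : Plane → Plane, ContDiff ℝ (⊤ : ℕ∞) ξ ∧ HasCompactSupport ξ ∧
    (∀ x, ‖ξ x‖ ≤ 1) ∧ r = ENNReal.ofReal (∫ x in E, divg ξ x)}

/-- The variational perimeter of a set `E ⊆ ℝ²`. -/
noncomputable def Per (E : Set Plane) : ℝ≥0∞ := sSup (perimVals E)

/-- `η` has distributional divergence `λ · χ_C`:
`∫ ⟨η, ∇φ⟩ = -λ ∫_C φ` for every smooth compactly supported `φ`. -/
def HasDistribDiv (η : Plane → Plane) (lam : ℝ) (C : Set Plane) : Prop :=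
  ∀ φ : Plane → ℝ, ContDiff ℝ (⊤ : ℕ∞) φ → HasCompactSupport φ →
    ∫ x : Plane, ⟪η x, gradient φ x⟫ = -lam * ∫ x in C, φ x

open scoped Convolution Topology
open Filter ContinuousLinearMap

/-- The trace, as a continuous linear functional on the endomorphisms of the plane. -/
noncomputable def traceCLM : (Plane →L[ℝ] Plane) →L[ℝ] ℝ :=
  LinearMap.toContinuousLinearMap (LinearMap.trace ℝ Plane ∘ₗ coeLM ℝ)

lemma traceCLM_apply (A : Plane →L[ℝ] Plane) :
    traceCLM A = LinearMap.trace ℝ Plane A.toLinearMap := rfl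

/-- If `η` has distributional divergence `lam · χ_C`, then the divergence of its mollification
by `ρ` is `lam · ρ ⋆ χ_C`. -/
lemma HasDistribDiv.divg_convolution {η : Plane → Plane} {lam : ℝ} {C : Set Plane}
    (hη : HasDistribDiv η lam C) (hC : MeasurableSet C)
    (hηl : LocallyIntegrable η volume) {ρ : Plane → ℝ}
    (hρ : ContDiff ℝ (⊤ : ℕ∞) ρ) (hρc : HasCompactSupport ρ) (x : Plane) :
    divg (ρ ⋆[lsmul ℝ ℝ, volume] η) x =
      lam * (ρ ⋆[lsmul ℝ ℝ, volume] C.indicator fun _ => (1 : ℝ)) x := by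
  have hρ1 : ContDiff ℝ 1 ρ := hρ.of_le (by exact_mod_cast le_top)
  have hD := hρc.hasFDerivAt_convolution_left (lsmul ℝ ℝ) hρ1 hηl x
  have hex : ConvolutionExists (fderiv ℝ ρ) η ((lsmul ℝ ℝ).precompL Plane) volume :=
    HasCompactSupport.convolutionExists_left _ (hρc.fderiv ℝ)
      (hρ1.continuous_fderiv one_ne_zero) hηl
  have hint := (hex x).integrable
  have hdivg : divg (ρ ⋆[lsmul ℝ ℝ, volume] η) x = ∫ t, fderiv ℝ ρ t (η (x - t)) := by
    rw [divg, hD.fderiv, convolution_def, ← traceCLM_apply, ← traceCLM.integral_comp_comm hint]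
    refine integral_congr_ae (Eventually.of_forall fun t => ?_)
    have : ((lsmul ℝ ℝ).precompL Plane (fderiv ℝ ρ t)) (η (x - t)) =
        (fderiv ℝ ρ t).smulRight (η (x - t)) := by
      ext1 v
      simp [precompL_apply]
    simp only [this, traceCLM_apply]
    exact LinearMap.trace_smulRight (fderiv ℝ ρ t).toLinearMap (η (x - t))
  have hgrad : ∀ y, ⟪η y, gradient (fun z => ρ (x - z)) y⟫ = -fderiv ℝ ρ (x - y) (η y) := by
    intro y
    have h : HasFDerivAt (fun z => ρ (x - z))
        ((fderiv ℝ ρ (x - y)).comp (-ContinuousLinearMap.id ℝ Plane)) y :=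
      ((hρ1.differentiable one_ne_zero) (x - y)).hasFDerivAt.comp y
        ((hasFDerivAt_id y).const_sub x)
    rw [real_inner_comm, inner_gradient_left, h.fderiv]
    simp
  have hφc : HasCompactSupport fun z => ρ (x - z) :=
    hρc.comp_homeomorph (Homeomorph.subLeft x)
  have key := hη (fun z => ρ (x - z)) (hρ.comp (contDiff_const.sub contDiff_id)) hφc
  simp_rw [hgrad] at key
  rw [integral_neg, neg_mul, neg_inj] at key
  rw [hdivg, ← integral_sub_left_eq_self _ volume x]
  simp only [sub_sub_cancel]
  rw [key, convolution_def, ← integral_sub_left_eq_self _ volume x, ← integral_indicator hC]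
  simp only [sub_sub_cancel, lsmul_apply]
  congr 2 with y
  by_cases hy : y ∈ C <;> simp [hy]

/-- Mollifying by a probability density does not increase an a.e. bound on the norm. -/
lemma ContDiffBump.norm_convolution_normed_le {E : Type*} [NormedAddCommGroup E]
    [NormedSpace ℝ E] (ρ : ContDiffBump (0 : Plane)) {g : Plane → E} {M : ℝ}
    (hg : ∀ᵐ x : Plane, ‖g x‖ ≤ M) (x : Plane) :
    ‖(ρ.normed volume ⋆[lsmul ℝ ℝ, volume] g) x‖ ≤ M := by
  have hM : ∀ᵐ t : Plane, ‖g (x - t)‖ ≤ M :=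
    (Measure.measurePreserving_sub_left volume x).quasiMeasurePreserving.ae hg
  rw [convolution_def]
  calc _ ≤ ∫ t, ρ.normed volume t * M := by
        refine norm_integral_le_of_norm_le (ρ.integrable_normed.mul_const M) ?_
        filter_upwards [hM] with t ht
        rw [lsmul_apply, norm_smul, Real.norm_of_nonneg (ρ.nonneg_normed t)]
        exact mul_le_mul_of_nonneg_left ht (ρ.nonneg_normed t)
    _ = M := by rw [integral_mul_const, ρ.integral_normed, one_mul]

/-- On a bounded set of finite perimeter, the fields testing the perimeter need not have
compact support. -/
lemma setIntegral_divg_le_Per {D : Set Plane} (hD : MeasurableSet D)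
    (hDbdd : Bornology.IsBounded D) (hDper : Per D ≠ ⊤) {F : Plane → Plane}
    (hF : ContDiff ℝ (⊤ : ℕ∞) F) (hF1 : ∀ x, ‖F x‖ ≤ 1) :
    ∫ x in D, divg F x ≤ (Per D).toReal := by
  obtain ⟨R, hR, hDR⟩ := hDbdd.subset_ball_lt 0 0
  let ψ : ContDiffBump (0 : Plane) := ⟨R, R + 1, hR, by linarith⟩
  have hψ : ∫ x in D, divg F x = ∫ x in D, divg (fun y => ψ y • F y) x := by
    refine setIntegral_congr_fun hD fun x hx => ?_
    have : (fun y => ψ y • F y) =ᶠ[𝓝 x] F := by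
      filter_upwards [ψ.eventuallyEq_one_of_mem_ball (hDR hx)] with y hy
      simp [hy]
    simp only [divg, this.fderiv_eq]
  rw [hψ]
  refine (ENNReal.ofReal_le_iff_le_toReal hDper).mp (le_sSup ⟨fun y => ψ y • F y,
    ψ.contDiff.smul hF, ψ.hasCompactSupport.smul_right, fun x => ?_, rfl⟩)
  rw [norm_smul, Real.norm_of_nonneg ψ.nonneg]
  exact mul_le_one₀ ψ.le_one (norm_nonneg _) (hF1 x)

/-- Pairing inequality: if `ξ` has `‖ξ‖ ≤ 1` a.e. and distributional divergence
`λ · χ_C`, then `λ · vol(C ∩ D) ≤ Per D` for every bounded measurable `D` of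
finite perimeter. -/
theorem pairing_inequality
    (C D : Set Plane) (hC : MeasurableSet C) (hD : MeasurableSet D)
    (hDbdd : Bornology.IsBounded D) (hDper : Per D ≠ ⊤)
    (lam : ℝ) (ξ : Plane → Plane) (hξm : Measurable ξ)
    (hξ1 : ∀ᵐ x : Plane, ‖ξ x‖ ≤ 1)
    (hdiv : HasDistribDiv ξ lam C) :
    lam * (volume (C ∩ D)).toReal ≤ (Per D).toReal := by
  have hξl : LocallyIntegrable ξ volume :=
    (memLp_top_of_bound hξm.aestronglyMeasurable 1 hξ1).locallyIntegrable le_top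
  have hχ1 : ∀ᵐ x : Plane, ‖C.indicator (fun _ => (1 : ℝ)) x‖ ≤ 1 :=
    Eventually.of_forall fun x =>
      (norm_indicator_le_norm_self (fun _ => (1 : ℝ)) x).trans_eq norm_one
  have hχl : LocallyIntegrable (C.indicator fun _ => (1 : ℝ)) (volume : Measure Plane) :=
    (memLp_top_of_bound (measurable_const.indicator hC).aestronglyMeasurable 1
      hχ1).locallyIntegrable le_top
  let ρ : ℕ → ContDiffBump (0 : Plane) := fun n =>
    ⟨1 / ((n : ℝ) + 1), 2 * (1 / ((n : ℝ) + 1)), Nat.one_div_pos_of_nat,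
      lt_mul_of_one_lt_left Nat.one_div_pos_of_nat one_lt_two⟩
  have hρ : Tendsto (fun n => (ρ n).rOut) atTop (𝓝 0) := by
    simpa [ρ] using (tendsto_one_div_add_atTop_nhds_zero_nat (𝕜 := ℝ)).const_mul 2
  have hcontDiff : ∀ n, ContDiff ℝ (⊤ : ℕ∞) ((ρ n).normed volume) := fun n =>
    (ρ n).contDiff_normed
  have hlim := ContDiffBump.ae_convolution_tendsto_right_of_locallyIntegrable
    (K := 2) hρ (Eventually.of_forall fun n => le_rfl) hχl
  have hle : ∀ n, lam * ∫ x in D,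
      ((ρ n).normed volume ⋆[lsmul ℝ ℝ, volume] C.indicator fun _ => (1 : ℝ)) x ≤
        (Per D).toReal := by
    intro n
    rw [← integral_const_mul]
    simp_rw [← hdiv.divg_convolution hC hξl (hcontDiff n) (ρ n).hasCompactSupport_normed]
    exact setIntegral_divg_le_Per hD hDbdd hDper
      ((ρ n).hasCompactSupport_normed.contDiff_convolution_left _ (hcontDiff n) hξl)
      ((ρ n).norm_convolution_normed_le hξ1)
  have hint : Tendsto (fun n => ∫ x in D,
      ((ρ n).normed volume ⋆[lsmul ℝ ℝ, volume] C.indicator fun _ => (1 : ℝ)) x) atTop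
      (𝓝 (∫ x in D, C.indicator (fun _ => (1 : ℝ)) x)) := by
    refine tendsto_integral_of_dominated_convergence (fun _ => 1) (fun n => ?_) ?_ (fun n => ?_)
      (ae_restrict_of_ae hlim)
    · exact ((ρ n).hasCompactSupport_normed.continuous_convolution_left _
        (ρ n).continuous_normed hχl).aestronglyMeasurable
    · exact integrableOn_const hDbdd.measure_lt_top.ne
    · exact Eventually.of_forall ((ρ n).norm_convolution_normed_le hχ1)
  have hvol : ∫ x in D, C.indicator (fun _ => (1 : ℝ)) x = (volume (C ∩ D)).toReal := by
    simp [integral_indicator hC, Measure.restrict_restrict hC, Measure.real]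
  rw [← hvol]
  exact le_of_tendsto' (hint.const_mul lam) hle
end

section
/- (Convexity Condition, part 2.) Let C ⊆ ℝ² be a bounded measurable set with 0 < vol(C) < ∞ and 0 < Per(C) < ∞, set λ_C = Per(C)/vol(C), and suppose C is calibrable: there exists a measurable ξ : ℝ² → ℝ² with ‖ξ(x)‖ ≤ 1 for almost every x and with distributional divergence λ_C·χ_C. Then for every measurable set D ⊆ C of finite variational perimeter with vol(D) > 0, one has λ_D ≥ λ_C, i.e. Per(D)/vol(D) ≥ Per(C)/vol(C). -/
open MeasureTheory RealInnerProductSpace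
open scoped ENNReal

open scoped Convolution Topology

/-- The mollification of a planar vector field `η` by the kernel `g`. -/
noncomputable def mollify (η : Plane → Plane) (g : Plane → ℝ) : Plane → Plane :=
  η ⋆[(ContinuousLinearMap.lsmul ℝ ℝ : ℝ →L[ℝ] Plane →L[ℝ] Plane).flip, volume] g

theorem locallyIntegrable_of_ae_norm_le_one {η : Plane → Plane} (hm : Measurable η)
    (h1 : ∀ᵐ x : Plane, ‖η x‖ ≤ 1) : LocallyIntegrable η :=
  (locallyIntegrable_const (1 : ℝ)).mono hm.aestronglyMeasurable (by simpa using h1)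

theorem norm_mollify_le_one {η : Plane → Plane} (h1 : ∀ᵐ x : Plane, ‖η x‖ ≤ 1)
    (f : ContDiffBump (0 : Plane)) (x : Plane) : ‖mollify η (f.normed volume) x‖ ≤ 1 := by
  have hi : Integrable (fun t : Plane => f.normed volume (x - t)) :=
    f.integrable_normed.comp_sub_left x
  calc ‖mollify η (f.normed volume) x‖ ≤ ∫ t : Plane, f.normed volume (x - t) := by
        refine norm_integral_le_of_norm_le hi ?_
        filter_upwards [h1] with t ht
        have h0 := f.nonneg_normed (μ := volume) (x - t)
        simp only [ContinuousLinearMap.flip_apply, ContinuousLinearMap.lsmul_apply, norm_smul,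
          Real.norm_of_nonneg h0]
        exact mul_le_of_le_one_right h0 ht
    _ = 1 := by rw [integral_sub_left_eq_self (f.normed volume) volume x, f.integral_normed]

/-- If `η` has distributional divergence `λ · χ_C`, the divergence of its mollification
by `g` is `λ` times the convolution of `g` with `χ_C`. -/
theorem HasDistribDiv.divg_mollify {η : Plane → Plane} {lam : ℝ} {C : Set Plane}
    (h : HasDistribDiv η lam C) (hη : LocallyIntegrable η) {g : Plane → ℝ}
    (hg : ContDiff ℝ (⊤ : ℕ∞) g) (hgc : HasCompactSupport g) (x : Plane) :
    divg (mollify η g) x = lam * ∫ t in C, g (x - t) := by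
  have hg1 : ContDiff ℝ 1 g := hg.of_le (by exact_mod_cast le_top)
  have hφ : ContDiff ℝ (⊤ : ℕ∞) (fun t => g (x - t)) := hg.comp (contDiff_const.sub contDiff_id)
  have hφc : HasCompactSupport (fun t => g (x - t)) :=
    hgc.comp_homeomorph (Homeomorph.subLeft x)
  set L := (ContinuousLinearMap.lsmul ℝ ℝ : ℝ →L[ℝ] Plane →L[ℝ] Plane).flip
  have hD : HasFDerivAt (mollify η g) _ x := hgc.hasFDerivAt_convolution_right L hη hg1 x
  have hint := (hgc.fderiv ℝ).convolutionExists_right (L.precompR Plane) hη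
    (hg1.continuous_fderiv one_ne_zero) x
  let T : (Plane →L[ℝ] Plane) →L[ℝ] ℝ :=
    LinearMap.toContinuousLinearMap
      ((LinearMap.trace ℝ Plane).comp (ContinuousLinearMap.coeLM ℝ))
  have hT : ∀ A : Plane →L[ℝ] Plane, T A = LinearMap.trace ℝ Plane A.toLinearMap := fun A => rfl
  have hgrad : ∀ t, T (L.precompR Plane (η t) (fderiv ℝ g (x - t)))
      = -⟪η t, gradient (fun s => g (x - s)) t⟫ := by
    intro t
    have e1 : (L.precompR Plane (η t) (fderiv ℝ g (x - t))).toLinearMap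
        = (fderiv ℝ g (x - t)).toLinearMap.smulRight (η t) := by
      ext w
      rfl
    have e2 : HasFDerivAt (fun s => g (x - s))
        ((fderiv ℝ g (x - t)).comp (-ContinuousLinearMap.id ℝ Plane)) t :=
      HasFDerivAt.comp t (hg1.differentiable one_ne_zero (x - t)).hasFDerivAt
        ((hasFDerivAt_id t).const_sub x)
    rw [hT, e1, LinearMap.trace_smulRight, inner_gradient_right, e2.fderiv]
    simp
  have hconv : divg (mollify η g) x
      = ∫ t : Plane, T (L.precompR Plane (η t) (fderiv ℝ g (x - t))) := by
    rw [divg, hD.fderiv, ← hT, convolution_def, ← T.integral_comp_comm hint]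
  rw [hconv]
  simp_rw [hgrad]
  rw [integral_neg, h _ hφ hφc]
  ring

/-- The divergence integral of a smooth field bounded by `1` over a bounded set is at most
the perimeter of the set, even if the field is not compactly supported. -/
theorem integral_divg_le_Per {D : Set Plane} (hD : MeasurableSet D)
    (hb : Bornology.IsBounded D) (hP : Per D ≠ ⊤) {F : Plane → Plane}
    (hF : ContDiff ℝ (⊤ : ℕ∞) F) (hF1 : ∀ x, ‖F x‖ ≤ 1) :
    ∫ x in D, divg F x ≤ (Per D).toReal := by
  obtain ⟨R, hR, hDR⟩ := hb.subset_ball_lt 0 (0 : Plane)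
  let ψ : ContDiffBump (0 : Plane) := ⟨R, R + 1, hR, lt_add_one R⟩
  have heq : ∫ x in D, divg F x = ∫ x in D, divg (fun y => ψ y • F y) x := by
    refine setIntegral_congr_fun hD fun x hx => ?_
    have hev : (fun y => ψ y • F y) =ᶠ[𝓝 x] F := by
      filter_upwards [Metric.isOpen_ball.mem_nhds (hDR hx)] with y hy
      rw [ψ.one_of_mem_closedBall (Metric.ball_subset_closedBall hy), one_smul]
    simp only [divg, hev.fderiv_eq]
  rw [heq, ← ENNReal.ofReal_le_iff_le_toReal hP]
  refine le_sSup ⟨fun y => ψ y • F y, ψ.contDiff.smul hF, ψ.hasCompactSupport.smul_right,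
    fun y => ?_, rfl⟩
  rw [norm_smul, Real.norm_of_nonneg ψ.nonneg]
  exact mul_le_one₀ ψ.le_one (norm_nonneg _) (hF1 y)

/-- Mollifications of `χ_C` integrate over `D ⊆ C` to nearly the volume of `D`. -/
theorem tendsto_setIntegral_normed {C D : Set Plane} (hC : MeasurableSet C) (hDC : D ⊆ C)
    (hD : MeasurableSet D) (hDT : volume D ≠ ⊤) {φ : ℕ → ContDiffBump (0 : Plane)} {K : ℝ}
    (hφ : Filter.Tendsto (fun n => (φ n).rOut) Filter.atTop (𝓝 0))
    (hK : ∀ n, (φ n).rOut ≤ K * (φ n).rIn) :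
    Filter.Tendsto (fun n => ∫ x in D, ∫ t in C, (φ n).normed volume (x - t))
      Filter.atTop (𝓝 (volume D).toReal) := by
  have hloc : LocallyIntegrable (C.indicator fun _ : Plane => (1 : ℝ)) :=
    (locallyIntegrable_const (1 : ℝ)).indicator hC
  have heq : ∀ n (x : Plane), ∫ t in C, (φ n).normed volume (x - t)
      = ((φ n).normed volume ⋆[ContinuousLinearMap.lsmul ℝ ℝ, volume]
        (C.indicator fun _ : Plane => (1 : ℝ))) x := by
    intro n x
    rw [convolution_eq_swap, ← integral_indicator hC]
    congr 1 with t
    by_cases ht : t ∈ C <;> simp [ht]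
  have hlim : ∫ _ in D, (1 : ℝ) = (volume D).toReal := by simp [Measure.real]
  rw [← hlim]
  simp_rw [heq]
  have : IsFiniteMeasure (volume.restrict D) := ⟨by simpa using hDT.lt_top⟩
  refine tendsto_integral_of_dominated_convergence (fun _ => (1 : ℝ)) (fun n => ?_)
    (integrable_const _) (fun n => ?_) ?_
  · exact ((φ n).hasCompactSupport_normed.continuous_convolution_left _
      (φ n).continuous_normed hloc).aestronglyMeasurable
  · refine Filter.Eventually.of_forall fun x => ?_
    have hnn : ∀ t, 0 ≤ (φ n).normed volume (x - t) := fun t => (φ n).nonneg_normed _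
    rw [← heq, Real.norm_of_nonneg (integral_nonneg hnn)]
    calc ∫ t in C, (φ n).normed volume (x - t) ≤ ∫ t, (φ n).normed volume (x - t) :=
          setIntegral_le_integral ((φ n).integrable_normed.comp_sub_left x)
            (Filter.Eventually.of_forall hnn)
      _ = 1 := by
          rw [integral_sub_left_eq_self ((φ n).normed volume) volume x, (φ n).integral_normed]
  · filter_upwards [ae_restrict_of_ae
      (ContDiffBump.ae_convolution_tendsto_right_of_locallyIntegrable hφ
      (Filter.Eventually.of_forall hK) hloc), ae_restrict_mem hD] with x hx hxD
    simpa [hDC hxD] using hx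

/-- Convexity condition, part 2: for a calibrable set `C`, every measurable
subset `D ⊆ C` of finite perimeter and positive volume satisfies
`λ_D ≥ λ_C`, i.e. `Per D / vol D ≥ Per C / vol C`. -/
theorem calibrable_subset_eigenvalue_ge
    (C : Set Plane) (hC : MeasurableSet C) (hCbdd : Bornology.IsBounded C)
    (hv0 : volume C ≠ 0) (hvT : volume C ≠ ⊤)
    (hp0 : Per C ≠ 0) (hpT : Per C ≠ ⊤)
    (ξ : Plane → Plane) (hξm : Measurable ξ)
    (hξ1 : ∀ᵐ x : Plane, ‖ξ x‖ ≤ 1)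
    (hdiv : HasDistribDiv ξ ((Per C).toReal / (volume C).toReal) C) :
    ∀ D : Set Plane, D ⊆ C → MeasurableSet D → Per D ≠ ⊤ → volume D ≠ 0 →
      (Per C).toReal / (volume C).toReal ≤ (Per D).toReal / (volume D).toReal := by
  intro D hDC hD hDP hD0
  have hDT : volume D ≠ ⊤ := measure_ne_top_of_subset hDC hvT
  have hDpos : 0 < (volume D).toReal := ENNReal.toReal_pos hD0 hDT
  rw [le_div_iff₀ hDpos]
  let φ : ℕ → ContDiffBump (0 : Plane) := fun n =>
    ⟨1 / ((n : ℝ) + 1), 2 * (1 / ((n : ℝ) + 1)), by positivity,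
      lt_two_mul_self (by positivity)⟩
  have hφ : Filter.Tendsto (fun n => (φ n).rOut) Filter.atTop (𝓝 0) := by
    simpa only [mul_zero] using (tendsto_one_div_add_atTop_nhds_zero_nat (𝕜 := ℝ)).const_mul 2
  have hlim := tendsto_setIntegral_normed hC hDC hD hDT hφ (K := 2) fun n => le_rfl
  refine le_of_tendsto (hlim.const_mul _) (Filter.Eventually.of_forall fun n => ?_)
  have hξ := locallyIntegrable_of_ae_norm_le_one hξm hξ1
  rw [← integral_const_mul]
  simp_rw [← hdiv.divg_mollify hξ (φ n).contDiff_normed (φ n).hasCompactSupport_normed]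
  exact integral_divg_le_Per hD (hCbdd.subset hDC) hDP
    ((φ n).hasCompactSupport_normed.contDiff_convolution_right _ hξ (φ n).contDiff_normed)
    (norm_mollify_le_one hξ1 (φ n))
end

section
/- (Bound on the anisotropy parameter by the convexity measure.) Let a ∈ (0,1], let A : ℝ² → L(ℝ², ℝ²) satisfy that A(x) is self-adjoint with operator norm ‖A(x)‖ ≤ 1 for every x, let C ⊆ ℝ² be a bounded measurable set with 0 < vol(C) < ∞ and 0 < Per(C) < ∞, set λ^A_C = a·Per(C)/vol(C), and suppose C is A-calibrable: there exists a measurable ξ : ℝ² → ℝ² with ‖ξ(x)‖ ≤ 1 for almost every x such that x ↦ A(x)(ξ(x)) has distributional divergence λ^A_C·χ_C. Then a·Per(C) ≤ Per(convexHull(C)); equivalently, a is at most the convexity measure Per(convexHull(C))/Per(C) of C. -/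
open MeasureTheory RealInnerProductSpace
open scoped ENNReal

open Filter Topology ContinuousLinearMap Convolution

lemma divg_eq_sum_inner (F : Plane → Plane) (x : Plane) :
    divg F x = ∑ i, ⟪EuclideanSpace.basisFun (Fin 2) ℝ i,
      fderiv ℝ F x (EuclideanSpace.basisFun (Fin 2) ℝ i)⟫ := by
  rw [divg, LinearMap.trace_eq_sum_inner _ (EuclideanSpace.basisFun (Fin 2) ℝ)]
  rfl

lemma continuous_divg {F : Plane → Plane} (hF : ContDiff ℝ (⊤ : ℕ∞) F) :
    Continuous (divg F) := by
  have h := hF.continuous_fderiv (by simp)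
  rw [funext (divg_eq_sum_inner F)]
  fun_prop

lemma hasCompactSupport_divg {F : Plane → Plane} (hF : HasCompactSupport F) :
    HasCompactSupport (divg F) :=
  (hF.fderiv (𝕜 := ℝ)).comp_left
    (g := fun T : Plane →L[ℝ] Plane => LinearMap.trace ℝ Plane T.toLinearMap) (by simp)

lemma divg_comp_add_right (F : Plane → Plane) (y x : Plane) :
    divg (fun z => F (z + y)) x = divg F (x + y) := by
  rw [divg, divg, fderiv_comp_add_right]

lemma contDiff_gradient {u : Plane → ℝ} (hu : ContDiff ℝ (⊤ : ℕ∞) u) :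
    ContDiff ℝ (⊤ : ℕ∞) (gradient u) :=
  (InnerProductSpace.toDual ℝ Plane).symm.contDiff.comp (hu.fderiv_right (m := (⊤ : ℕ∞)) (by simp))

lemma support_gradient_subset (u : Plane → ℝ) :
    Function.support (gradient u) ⊆ tsupport u := by
  intro x hx
  apply support_fderiv_subset ℝ
  intro h
  exact hx (by simp [gradient, h])

lemma hasCompactSupport_gradient {u : Plane → ℝ} (hu : HasCompactSupport u) :
    HasCompactSupport (gradient u) :=
  hu.mono' (support_gradient_subset u)

/-- Integration by parts for the gradient and the divergence. -/
lemma integral_inner_gradient_eq_neg_integral_mul_divg {u : Plane → ℝ} {ζ : Plane → Plane}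
    (hu : ContDiff ℝ (⊤ : ℕ∞) u) (hζ : ContDiff ℝ (⊤ : ℕ∞) ζ) (hζc : HasCompactSupport ζ) :
    ∫ x, ⟪ζ x, gradient u x⟫ = -∫ x, u x * divg ζ x := by
  set b := EuclideanSpace.basisFun (Fin 2) ℝ
  have hdu : Differentiable ℝ u := hu.differentiable (by simp)
  have hdζ : Differentiable ℝ ζ := hζ.differentiable (by simp)
  have hcu := hu.continuous_fderiv (by simp)
  have hcζ := hζ.continuous_fderiv (by simp)
  have hu0 := hu.continuous
  have hζ0 := hζ.continuous
  have hfd : ∀ i x, fderiv ℝ (fun z => ⟪b i, ζ z⟫) x (b i) = ⟪b i, fderiv ℝ ζ x (b i)⟫ := by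
    intro i x
    rw [fderiv_inner_apply ℝ (by fun_prop) (hdζ x)]
    simp
  have hζi : ∀ i, HasCompactSupport (fun x => ⟪b i, ζ x⟫) := fun i =>
    hζc.comp_left (g := fun z => ⟪b i, z⟫) (by simp)
  have hζi' : ∀ i, HasCompactSupport (fun x => ⟪b i, fderiv ℝ ζ x (b i)⟫) := fun i =>
    (hζc.fderiv (𝕜 := ℝ)).comp_left (g := fun T : Plane →L[ℝ] Plane => ⟪b i, T (b i)⟫) (by simp)
  have hint1 : ∀ i, Integrable (fun x => fderiv ℝ u x (b i) * ⟪b i, ζ x⟫) := fun i =>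
    Continuous.integrable_of_hasCompactSupport (by fun_prop) (hζi i).mul_left
  have hint2 : ∀ i, Integrable (fun x => u x * ⟪b i, fderiv ℝ ζ x (b i)⟫) := fun i =>
    Continuous.integrable_of_hasCompactSupport (by fun_prop) (hζi' i).mul_left
  have hibp : ∀ i, ∫ x, u x * ⟪b i, fderiv ℝ ζ x (b i)⟫ =
      -∫ x, fderiv ℝ u x (b i) * ⟪b i, ζ x⟫ := by
    intro i
    have := integral_mul_fderiv_eq_neg_fderiv_mul_of_integrable (μ := volume) (f := u)
      (g := fun z => ⟪b i, ζ z⟫) (v := b i) (hint1 i) (by simpa only [hfd] using hint2 i)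
      (Continuous.integrable_of_hasCompactSupport (by fun_prop) (hζi i).mul_left)
      (fun x _ => hdu x) (fun x _ => (differentiableAt_const _).inner ℝ (hdζ x))
    simpa only [hfd] using this
  have h1 : ∀ x, ⟪ζ x, gradient u x⟫ = ∑ i, fderiv ℝ u x (b i) * ⟪b i, ζ x⟫ := by
    intro x
    rw [← b.sum_inner_mul_inner]
    refine Finset.sum_congr rfl fun i _ => ?_
    rw [inner_gradient_right, real_inner_comm, mul_comm]
    simp
  have h2 : ∀ x, u x * divg ζ x = ∑ i, u x * ⟪b i, fderiv ℝ ζ x (b i)⟫ := by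
    intro x
    rw [divg_eq_sum_inner, Finset.mul_sum]
  simp_rw [h1, h2]
  rw [integral_finsetSum _ fun i _ => hint1 i, integral_finsetSum _ fun i _ => hint2 i,
    ← Finset.sum_neg_distrib]
  exact Finset.sum_congr rfl fun i _ => by rw [hibp i, neg_neg]

lemma setIntegral_divg_le_per {E : Set Plane} (hE : Per E ≠ ⊤) {ζ : Plane → Plane}
    (hζ : ContDiff ℝ (⊤ : ℕ∞) ζ) (hζc : HasCompactSupport ζ) (hζ1 : ∀ x, ‖ζ x‖ ≤ 1) :
    ∫ x in E, divg ζ x ≤ (Per E).toReal :=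
  (ENNReal.ofReal_le_iff_le_toReal hE).1 (le_sSup ⟨ζ, hζ, hζc, hζ1, rfl⟩)

lemma per_congr_ae {E F : Set Plane} (h : E =ᵐ[volume] F) : Per E = Per F := by
  simp only [Per, perimVals, setIntegral_congr_set h]

/-- The mollification of the indicator function of `E` by `ρ`. -/
noncomputable def mollifiedIndicator (ρ : ContDiffBump (0 : Plane)) (E : Set Plane) :
    Plane → ℝ :=
  ρ.normed volume ⋆[lsmul ℝ ℝ, volume] E.indicator fun _ => (1 : ℝ)

lemma locallyIntegrable_indicator_one {E : Set Plane} (hE : MeasurableSet E) :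
    LocallyIntegrable (E.indicator fun _ => (1 : ℝ)) (volume : Measure Plane) :=
  (locallyIntegrable_const 1).indicator hE

lemma contDiff_mollifiedIndicator (ρ : ContDiffBump (0 : Plane)) {E : Set Plane}
    (hE : MeasurableSet E) : ContDiff ℝ (⊤ : ℕ∞) (mollifiedIndicator ρ E) :=
  ρ.hasCompactSupport_normed.contDiff_convolution_left _ ρ.contDiff_normed
    (locallyIntegrable_indicator_one hE)

lemma hasCompactSupport_mollifiedIndicator (ρ : ContDiffBump (0 : Plane)) {E : Set Plane}
    (hE : IsCompact E) : HasCompactSupport (mollifiedIndicator ρ E) :=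
  ρ.hasCompactSupport_normed.convolution _
    (HasCompactSupport.intro hE fun _ hx => Set.indicator_of_notMem hx _)

lemma abs_mollifiedIndicator_le_one (ρ : ContDiffBump (0 : Plane)) (E : Set Plane) (x : Plane) :
    |mollifiedIndicator ρ E x| ≤ 1 := by
  rw [← ρ.integral_normed (μ := volume), ← Real.norm_eq_abs, mollifiedIndicator, convolution_def]
  refine norm_integral_le_of_norm_le ρ.integrable_normed (Eventually.of_forall fun y => ?_)
  simp only [lsmul_apply, smul_eq_mul, norm_mul, Real.norm_of_nonneg (ρ.nonneg_normed y)]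
  refine mul_le_of_le_one_right (ρ.nonneg_normed y) ?_
  by_cases h : x - y ∈ E <;> simp [h]

lemma integral_mollifiedIndicator_mul_divg_le (ρ : ContDiffBump (0 : Plane)) {E : Set Plane}
    (hE : MeasurableSet E) (hP : Per E ≠ ⊤) {ζ : Plane → Plane}
    (hζ : ContDiff ℝ (⊤ : ℕ∞) ζ) (hζc : HasCompactSupport ζ) (hζ1 : ∀ x, ‖ζ x‖ ≤ 1) :
    ∫ x, mollifiedIndicator ρ E x * divg ζ x ≤ (Per E).toReal := by
  set g : Plane → ℝ := E.indicator fun _ => (1 : ℝ)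
  set r := ρ.normed volume
  have hg : Measurable g := measurable_const.indicator hE
  have hd : Integrable (divg ζ) :=
    (continuous_divg hζ).integrable_of_hasCompactSupport (hasCompactSupport_divg hζc)
  have hint : Integrable (fun p : Plane × Plane => r p.2 * g (p.1 - p.2) * divg ζ p.1)
      (volume.prod volume) := by
    have h := (hd.mul_prod (ρ.integrable_normed (μ := volume))).bdd_mul (c := 1)
      (f := fun p : Plane × Plane => g (p.1 - p.2))
      (hg.comp (measurable_fst.sub measurable_snd)).aestronglyMeasurable
      (Eventually.of_forall fun p => by by_cases h : p.1 - p.2 ∈ E <;> simp [g, h])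
    refine h.congr (Eventually.of_forall fun p => ?_)
    simp only [r]
    ring
  have htrans : ∀ y, ∫ x, g (x - y) * divg ζ x ≤ (Per E).toReal := by
    intro y
    rw [← integral_add_right_eq_self _ y]
    have := setIntegral_divg_le_per hP (ζ := fun z => ζ (z + y)) (by fun_prop)
      (hζc.comp_homeomorph (Homeomorph.addRight y)) (fun x => hζ1 _)
    rw [← integral_indicator hE] at this
    refine le_of_eq_of_le (integral_congr_ae (Eventually.of_forall fun x => ?_)) this
    by_cases h : x ∈ E <;> simp [g, h, divg_comp_add_right]
  calc ∫ x, mollifiedIndicator ρ E x * divg ζ x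
      = ∫ x, ∫ y, r y * g (x - y) * divg ζ x := by
        refine integral_congr_ae (Eventually.of_forall fun x => ?_)
        simp only [mollifiedIndicator, convolution_def, lsmul_apply, smul_eq_mul]
        rw [← integral_mul_const]
    _ = ∫ y, ∫ x, r y * g (x - y) * divg ζ x := integral_integral_swap hint
    _ ≤ ∫ y, r y * (Per E).toReal := by
        refine integral_mono hint.integral_prod_right
          (ρ.integrable_normed.mul_const _) fun y => ?_
        simp only [mul_assoc, integral_const_mul]
        exact mul_le_mul_of_nonneg_left (htrans y) (ρ.nonneg_normed y)
    _ = (Per E).toReal := by rw [integral_mul_const, ρ.integral_normed, one_mul]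

/-- If `u` pairs with divergences of admissible fields to at most `P`, then its total variation is
at most `P`. -/
lemma integral_norm_gradient_le {u : Plane → ℝ} (hu : ContDiff ℝ (⊤ : ℕ∞) u)
    (huc : HasCompactSupport u) {P : ℝ}
    (hP : ∀ ζ : Plane → Plane, ContDiff ℝ (⊤ : ℕ∞) ζ → HasCompactSupport ζ → (∀ x, ‖ζ x‖ ≤ 1) →
      ∫ x, u x * divg ζ x ≤ P) :
    ∫ x, ‖gradient u x‖ ≤ P := by
  have hG := contDiff_gradient hu
  have hGc := hasCompactSupport_gradient huc
  have hG0 := hG.continuous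
  set S := tsupport u
  have hS : IsCompact S := huc
  have key : ∀ δ : ℝ, 0 < δ → ∫ x, ‖gradient u x‖ ≤ P + δ * volume.real S := by
    intro δ hδ
    have hpos : ∀ x, 0 < δ ^ 2 + ‖gradient u x‖ ^ 2 := fun x => by positivity
    have hs : ∀ x, 0 < √(δ ^ 2 + ‖gradient u x‖ ^ 2) := fun x => Real.sqrt_pos.2 (hpos x)
    set ζ : Plane → Plane := fun x => -((√(δ ^ 2 + ‖gradient u x‖ ^ 2))⁻¹ • gradient u x) with hζdef
    have hζ : ContDiff ℝ (⊤ : ℕ∞) ζ :=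
      ((((contDiff_const.add (hG.norm_sq ℝ)).sqrt fun x => (hpos x).ne').inv
        fun x => (hs x).ne').smul hG).neg
    have hζc : HasCompactSupport ζ :=
      hGc.mono fun x hx h => hx (by simp [hζdef, h])
    have hζ1 : ∀ x, ‖ζ x‖ ≤ 1 := by
      intro x
      rw [hζdef, norm_neg, norm_smul, norm_inv, Real.norm_of_nonneg (hs x).le,
        inv_mul_le_one₀ (hs x)]
      exact Real.le_sqrt_of_sq_le (by nlinarith)
    have h1 := hP ζ hζ hζc hζ1
    have h2 := integral_inner_gradient_eq_neg_integral_mul_divg hu hζ hζc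
    have hζ0 := hζ.continuous
    have hi1 : Integrable (fun x => -⟪ζ x, gradient u x⟫) :=
      Continuous.integrable_of_hasCompactSupport (by fun_prop)
        (hGc.mono (fun x hx h => hx (by simp [h])))
    have hi2 : Integrable (S.indicator fun _ => δ) :=
      (integrable_indicator_iff hS.measurableSet).2 (integrableOn_const hS.measure_ne_top)
    calc ∫ x, ‖gradient u x‖
        ≤ ∫ x, (-⟪ζ x, gradient u x⟫ + S.indicator (fun _ => δ) x) := by
          refine integral_mono (hG0.norm.integrable_of_hasCompactSupport hGc.norm)
            (hi1.add hi2) fun x => ?_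
          by_cases hx : x ∈ S
          · simp only [Set.indicator_of_mem hx, hζdef, inner_neg_left, neg_neg,
              real_inner_smul_left, real_inner_self_eq_norm_sq]
            have hsx := hs x
            have hsq := Real.sq_sqrt (hpos x).le
            set s := √(δ ^ 2 + ‖gradient u x‖ ^ 2)
            set p := ‖gradient u x‖
            have hp : 0 ≤ p := norm_nonneg _
            have hps : p ≤ s := by nlinarith
            have hsp : s ≤ δ + p := by nlinarith
            rw [← sub_nonneg]
            have : s⁻¹ * p ^ 2 + δ - p = s⁻¹ * (p ^ 2 + (δ - p) * s) := by field_simp; ring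
            rw [this]
            refine mul_nonneg (inv_nonneg.2 hsx.le) ?_
            nlinarith
          · have : gradient u x = 0 := by
              by_contra h
              exact hx (support_gradient_subset u h)
            simp [this, hx]
      _ = (∫ x, u x * divg ζ x) + δ * volume.real S := by
          rw [integral_add hi1 hi2, integral_neg, h2, neg_neg,
            integral_indicator hS.measurableSet, setIntegral_const, smul_eq_mul, mul_comm δ]
      _ ≤ P + δ * volume.real S := by gcongr
  have hlim : Tendsto (fun δ : ℝ => P + δ * volume.real S) (𝓝[>] 0) (𝓝 P) := by
    have : Tendsto (fun δ : ℝ => P + δ * volume.real S) (𝓝 0) (𝓝 (P + 0 * volume.real S)) :=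
      Continuous.tendsto (by fun_prop) 0
    rw [zero_mul, add_zero] at this
    exact this.mono_left nhdsWithin_le_nhds
  exact ge_of_tendsto hlim (eventually_mem_nhdsWithin.mono fun δ hδ => key δ hδ)

/-- The isoperimetric inequality satisfied by a set that carries a calibrating field: its weighted
volume is bounded by the perimeter of every compact set containing it. -/
lemma mul_volume_le_per_of_hasDistribDiv {η : Plane → Plane} {lam : ℝ} {C E : Set Plane}
    (hη : ∀ᵐ x : Plane, ‖η x‖ ≤ 1) (hdiv : HasDistribDiv η lam C) (hC : MeasurableSet C)
    (hE : IsCompact E) (hCE : C ⊆ E) (hP : Per E ≠ ⊤) :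
    lam * (volume C).toReal ≤ (Per E).toReal := by
  have hCfin : volume C ≠ ⊤ := ne_top_of_le_ne_top hE.measure_ne_top (measure_mono hCE)
  have hbound : ∀ ρ : ContDiffBump (0 : Plane),
      lam * ∫ x in C, mollifiedIndicator ρ E x ≤ (Per E).toReal := by
    intro ρ
    have hu := contDiff_mollifiedIndicator ρ hE.measurableSet
    have huc := hasCompactSupport_mollifiedIndicator ρ hE
    have h1 := integral_norm_gradient_le hu huc fun ζ hζ hζc hζ1 =>
      integral_mollifiedIndicator_mul_divg_le ρ hE.measurableSet hP hζ hζc hζ1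
    have h2 := hdiv _ hu huc
    have h3 : ‖∫ x, ⟪η x, gradient (mollifiedIndicator ρ E) x⟫‖ ≤
        ∫ x, ‖gradient (mollifiedIndicator ρ E) x‖ := by
      refine norm_integral_le_of_norm_le
        ((contDiff_gradient hu).continuous.norm.integrable_of_hasCompactSupport
          (hasCompactSupport_gradient huc).norm) ?_
      filter_upwards [hη] with x hx
      exact (norm_inner_le_norm _ _).trans (mul_le_of_le_one_left (norm_nonneg _) hx)
    rw [Real.norm_eq_abs, h2] at h3
    have := (abs_le.1 (h3.trans h1)).1
    linarith
  let ρ : ℕ → ContDiffBump (0 : Plane) := fun n =>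
    { rIn := 1 / ((n : ℝ) + 1)
      rOut := 2 * (1 / ((n : ℝ) + 1))
      rIn_pos := by positivity
      rIn_lt_rOut := by
        have : 0 < 1 / ((n : ℝ) + 1) := by positivity
        linarith }
  have hρ : Tendsto (fun n => (ρ n).rOut) atTop (𝓝 0) := by
    have h := (tendsto_one_div_add_atTop_nhds_zero_nat (𝕜 := ℝ)).const_mul (2 : ℝ)
    rwa [mul_zero] at h
  have hae := ContDiffBump.ae_convolution_tendsto_right_of_locallyIntegrable (K := 2) hρ
    (Eventually.of_forall fun _ => le_rfl) (locallyIntegrable_indicator_one hE.measurableSet)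
  have hlim : Tendsto (fun n => ∫ x in C, mollifiedIndicator (ρ n) E x) atTop
      (𝓝 (∫ _ in C, (1 : ℝ))) := by
    refine tendsto_integral_of_dominated_convergence (fun _ => 1) (fun n => ?_)
      (integrableOn_const hCfin) (fun n => ?_) ?_
    · exact (contDiff_mollifiedIndicator (ρ n) hE.measurableSet).continuous.aestronglyMeasurable
    · exact Eventually.of_forall fun x => abs_mollifiedIndicator_le_one _ _ _
    · filter_upwards [ae_restrict_of_ae hae, ae_restrict_mem hC] with x hx hxC
      rwa [Set.indicator_of_mem (hCE hxC)] at hx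
  rw [setIntegral_const, smul_eq_mul, mul_one] at hlim
  exact le_of_tendsto (hlim.const_mul lam) (Eventually.of_forall fun n => hbound (ρ n))

/-- Bound on the anisotropy parameter by the convexity measure: if `C` is
`A`-calibrable with anisotropy parameter `a ∈ (0,1]`, then
`a · Per C ≤ Per (convexHull ℝ C)`, i.e. `a` is at most the convexity measure
`Per (convexHull ℝ C) / Per C` of `C`. -/
theorem anisotropy_le_convexity_measure
    (a : ℝ) (ha : a ∈ Set.Ioc (0 : ℝ) 1)
    (A : Plane → (Plane →L[ℝ] Plane))
    (hAsa : ∀ x : Plane, ∀ y z : Plane, ⟪A x y, z⟫ = ⟪y, A x z⟫)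
    (hAnorm : ∀ x : Plane, ‖A x‖ ≤ 1)
    (C : Set Plane) (hC : MeasurableSet C) (hCbdd : Bornology.IsBounded C)
    (hv0 : volume C ≠ 0) (hvT : volume C ≠ ⊤)
    (hp0 : Per C ≠ 0) (hpT : Per C ≠ ⊤)
    (ξ : Plane → Plane) (hξm : Measurable ξ)
    (hξ1 : ∀ᵐ x : Plane, ‖ξ x‖ ≤ 1)
    (hdiv : HasDistribDiv (fun x => A x (ξ x))
      (a * (Per C).toReal / (volume C).toReal) C) :
    ENNReal.ofReal a * Per C ≤ Per (convexHull ℝ C) := by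
  have hae : (closure (convexHull ℝ C) : Set Plane) =ᵐ[volume] convexHull ℝ C := by
    refine Filter.EventuallyLE.antisymm (ae_le_set.2 ?_)
      (LE.le.eventuallyLE (subset_closure (s := convexHull ℝ C)))
    exact measure_mono_null (Set.sdiff_subset_sdiff_right interior_subset)
      ((convex_convexHull ℝ C).addHaar_frontier volume)
  rw [← per_congr_ae hae]
  by_cases hP : Per (closure (convexHull ℝ C)) = ⊤
  · simp [hP]
  have hη : ∀ᵐ x : Plane, ‖A x (ξ x)‖ ≤ 1 := by
    filter_upwards [hξ1] with x hx
    exact (A x).le_of_opNorm_le_of_le (hAnorm x) hx |>.trans_eq (one_mul 1)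
  have hcompact : IsCompact (closure (convexHull ℝ C)) :=
    (isBounded_convexHull.2 hCbdd).isCompact_closure
  have h := mul_volume_le_per_of_hasDistribDiv hη hdiv hC hcompact
    ((subset_convexHull ℝ C).trans subset_closure) hP
  rw [div_mul_cancel₀ _ (ENNReal.toReal_ne_zero.2 ⟨hv0, hvT⟩)] at h
  rw [← ENNReal.ofReal_toReal hpT, ← ENNReal.ofReal_mul ha.1.le]
  exact ENNReal.ofReal_le_of_le_toReal h
end
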